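/- arXiv:2406.15256 — 4 statements merged into one kernel-verified Lean document; each statement's English description precedes it below -/
import Mathlib

section
/- Let E, X, Y, Z be types, f : X → Z and g : Y → Z functions, and m : X ⊕ E → Y ⊕ E a function such that Sum.map g (id : E → E) ∘ m = Sum.map f id. Then there exists a unique function h : X → Y such that g ∘ h = f and m = Sum.map h id. (That is, the exception endofunctor (· ⊕ E) of Type is relatively full and faithful: every morphism of Type is cartesian with respect to it.) -/
/-- The exception endofunctor `(· ⊕ E)` of `Type` is relatively full and faithful:
every morphism of `Type` is cartesian with respect to it. -/
theorem stmt_9 {E X Y Z : Type*} (f : X → Z) (g : Y → Z) (m : X ⊕ E → Y ⊕ E)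
    (hm : Sum.map g (id : E → E) ∘ m = Sum.map f (id : E → E)) :
    ∃! h : X → Y, g ∘ h = f ∧ m = Sum.map h (id : E → E) := by
  have inl_lift : ∀ x, ∃ y, m (Sum.inl x) = Sum.inl y ∧ g y = f x := by
    intro x
    have hx := congrFun hm (Sum.inl x)
    cases hmx : m (Sum.inl x) <;> simp_all
  have inr_fixed : ∀ e, m (Sum.inr e) = Sum.inr e := by
    intro e
    have he := congrFun hm (Sum.inr e)
    cases hme : m (Sum.inr e) <;> simp_all
  choose h hmh hgh using inl_lift
  refine ⟨h, ⟨funext hgh, ?_⟩, ?_⟩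
  · funext s
    cases s with
    | inl x => exact hmh x
    | inr e => exact inr_fixed e
  · rintro k ⟨-, hk⟩
    funext x
    have hx := hmh x
    rw [hk] at hx
    exact Sum.inl_injective hx
end

section
/- Let E be a finite type. For each type X define δ_X : Ultrafilter (X ⊕ E) → Ultrafilter X ⊕ E by: if Set.range Sum.inl ∈ 𝔉 then δ_X 𝔉 = Sum.inl 𝒢, where 𝒢 is the unique ultrafilter on X with Ultrafilter.map Sum.inl 𝒢 = 𝔉; otherwise δ_X 𝔉 = Sum.inr e, where e is the unique element of E with 𝔉 = pure (Sum.inr e). Then δ_X is a well-defined bijection, natural in X, and δ is an invertible distributive law between the ultrafilter monad and the exception monad (· ⊕ E); that is: (1) for every w : X ⊕ E, δ_X (pure w) = Sum.map pure id w; (2) for every 𝒢 : Ultrafilter X, δ_X (Ultrafilter.map Sum.inl 𝒢) = Sum.inl 𝒢; (3) writing ρ_Y : (Y ⊕ E) ⊕ E → Y ⊕ E for Sum.elim id Sum.inr, for every 𝔉 : Ultrafilter ((X ⊕ E) ⊕ E) one has δ_X (Ultrafilter.map ρ_X 𝔉) = ρ_{Ultrafilter X} (Sum.map δ_X id (δ_{X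 ⊕ E} 𝔉)); (4) writing joinU : Ultrafilter (Ultrafilter Z) → Ultrafilter Z for the multiplication of the ultrafilter monad (joinU 𝔊 = 𝔊.bind id), for every 𝔊 : Ultrafilter (Ultrafilter (X ⊕ E)) one has δ_X (joinU 𝔊) = Sum.map joinU id (δ_{Ultrafilter X} (Ultrafilter.map δ_X 𝔊)). -/
universe u

/-- The multiplication of the ultrafilter monad. -/
def joinU {Z : Type u} (𝔊 : Ultrafilter (Ultrafilter Z)) : Ultrafilter Z :=
  𝔊.bind id

theorem joinU_pure {Z : Type u} (F : Ultrafilter Z) : joinU (pure F) = F :=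
  Ultrafilter.ext fun _ => Iff.rfl

theorem joinU_map_map {Y Z : Type u} (f : Y → Z) (𝔊 : Ultrafilter (Ultrafilter Y)) :
    joinU (Ultrafilter.map (Ultrafilter.map f) 𝔊) = Ultrafilter.map f (joinU 𝔊) :=
  Ultrafilter.ext fun _ => Iff.rfl

theorem Ultrafilter.map_injective {Y Z : Type u} {f : Y → Z} (hf : Function.Injective f) :
    Function.Injective (Ultrafilter.map f) := fun _ _ h =>
  Ultrafilter.coe_injective <| Filter.map_injective hf <| congrArg Ultrafilter.toFilter h

/-- The canonical map from `Ultrafilter X ⊕ E` to the ultrafilters on `X ⊕ E`. -/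
def ofSum (E X : Type u) : Ultrafilter X ⊕ E → Ultrafilter (X ⊕ E) :=
  Sum.elim (Ultrafilter.map Sum.inl) (fun e => pure (Sum.inr e))

theorem range_inl_mem_map_inl {E X : Type u} (𝒢 : Ultrafilter X) :
    Set.range (Sum.inl : X → X ⊕ E) ∈ Ultrafilter.map Sum.inl 𝒢 :=
  Ultrafilter.mem_map.2 <| Filter.univ_mem' Set.mem_range_self

theorem range_inl_notMem_pure_inr {E X : Type u} (e : E) :
    Set.range (Sum.inl : X → X ⊕ E) ∉ (pure (Sum.inr e) : Ultrafilter (X ⊕ E)) := by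
  simp [Ultrafilter.mem_pure]

theorem ofSum_injective (E X : Type u) : Function.Injective (ofSum E X) := by
  refine (Ultrafilter.map_injective Sum.inl_injective).sumElim
    (Ultrafilter.pure_injective.comp Sum.inr_injective) fun 𝒢 e h => ?_
  exact range_inl_notMem_pure_inr e (h ▸ range_inl_mem_map_inl 𝒢)

theorem ofSum_surjective (E X : Type u) [Finite E] : Function.Surjective (ofSum E X) := by
  intro 𝔉
  by_cases h : Set.range (Sum.inl : X → X ⊕ E) ∈ 𝔉
  · rw [← Set.image_univ] at h
    exact ⟨Sum.inl (Ultrafilter.ofComapInfPrincipal h),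
      Ultrafilter.ofComapInfPrincipal_eq_of_map h⟩
  · rw [← Ultrafilter.compl_mem_iff_notMem, Set.compl_range_inl] at h
    obtain ⟨_, ⟨e, rfl⟩, rfl⟩ := Ultrafilter.eq_pure_of_finite_mem (Set.finite_range _) h
    exact ⟨Sum.inr e, rfl⟩

/-- For finite `E`, an ultrafilter on `X ⊕ E` is an ultrafilter on `X` or an element of `E`. -/
noncomputable def sumEquiv (E X : Type u) [Finite E] :
    Ultrafilter (X ⊕ E) ≃ Ultrafilter X ⊕ E :=
  (Equiv.ofBijective (ofSum E X) ⟨ofSum_injective E X, ofSum_surjective E X⟩).symm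

section

variable {E X : Type u} [Finite E]

theorem sumEquiv_ofSum (s : Ultrafilter X ⊕ E) : sumEquiv E X (ofSum E X s) = s :=
  Equiv.ofBijective_symm_apply_apply _ _ s

theorem sumEquiv_map_inl (𝒢 : Ultrafilter X) :
    sumEquiv E X (Ultrafilter.map Sum.inl 𝒢) = Sum.inl 𝒢 :=
  sumEquiv_ofSum (Sum.inl 𝒢)

theorem sumEquiv_pure_inr (e : E) : sumEquiv E X (pure (Sum.inr e)) = Sum.inr e :=
  sumEquiv_ofSum (Sum.inr e)

theorem eq_map_inl_or_eq_pure_inr (𝔉 : Ultrafilter (X ⊕ E)) :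
    (∃ 𝒢 : Ultrafilter X, 𝔉 = Ultrafilter.map Sum.inl 𝒢) ∨ ∃ e : E, 𝔉 = pure (Sum.inr e) := by
  obtain ⟨𝒢 | e, rfl⟩ := ofSum_surjective E X 𝔉
  exacts [Or.inl ⟨𝒢, rfl⟩, Or.inr ⟨e, rfl⟩]

theorem sumEquiv_map_sumMap {Y : Type u} (f : X → Y) (𝔉 : Ultrafilter (X ⊕ E)) :
    sumEquiv E Y (Ultrafilter.map (Sum.map f id) 𝔉) =
      Sum.map (Ultrafilter.map f) id (sumEquiv E X 𝔉) := by
  obtain ⟨𝒢, rfl⟩ | ⟨e, rfl⟩ := eq_map_inl_or_eq_pure_inr 𝔉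
  · rw [sumEquiv_map_inl, Ultrafilter.map_map,
      show Sum.map f (id : E → E) ∘ Sum.inl = Sum.inl ∘ f from rfl, ← Ultrafilter.map_map,
      sumEquiv_map_inl, Sum.map_inl]
  · rw [Ultrafilter.map_pure, Sum.map_inr, sumEquiv_pure_inr, sumEquiv_pure_inr, Sum.map_inr]

theorem sumEquiv_pure (w : X ⊕ E) : sumEquiv E X (pure w) = Sum.map pure id w := by
  cases w with
  | inl x => rw [← Ultrafilter.map_pure, sumEquiv_map_inl, Sum.map_inl]
  | inr e => exact sumEquiv_pure_inr e

theorem sumEquiv_map_sumElim (𝔉 : Ultrafilter ((X ⊕ E) ⊕ E)) :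
    sumEquiv E X (Ultrafilter.map (Sum.elim id Sum.inr) 𝔉) =
      Sum.elim id Sum.inr (Sum.map (sumEquiv E X) id (sumEquiv E (X ⊕ E) 𝔉)) := by
  obtain ⟨𝒢, rfl⟩ | ⟨e, rfl⟩ := eq_map_inl_or_eq_pure_inr 𝔉
  · rw [sumEquiv_map_inl, Ultrafilter.map_map, Sum.elim_comp_inl, Ultrafilter.map_id]
    rfl
  · rw [sumEquiv_pure_inr, Ultrafilter.map_pure]
    exact sumEquiv_pure_inr e

theorem sumEquiv_joinU (𝔊 : Ultrafilter (Ultrafilter (X ⊕ E))) :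
    sumEquiv E X (joinU 𝔊) =
      Sum.map joinU id (sumEquiv E (Ultrafilter X) (Ultrafilter.map (sumEquiv E X) 𝔊)) := by
  obtain ⟨ℌ, rfl⟩ : ∃ ℌ, 𝔊 = Ultrafilter.map (ofSum E X) ℌ :=
    ⟨Ultrafilter.map (sumEquiv E X) 𝔊, by
      rw [Ultrafilter.map_map]
      exact ((congrArg (Ultrafilter.map · 𝔊) (sumEquiv E X).symm_comp_self).trans
        𝔊.map_id).symm⟩
  rw [Ultrafilter.map_map, show sumEquiv E X ∘ ofSum E X = id from funext sumEquiv_ofSum,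
    Ultrafilter.map_id]
  obtain ⟨𝒢, rfl⟩ | ⟨e, rfl⟩ := eq_map_inl_or_eq_pure_inr ℌ
  · rw [sumEquiv_map_inl, Ultrafilter.map_map, ofSum, Sum.elim_comp_inl, joinU_map_map,
      sumEquiv_map_inl, Sum.map_inl]
  · rw [sumEquiv_pure_inr, Ultrafilter.map_pure, joinU_pure]
    exact sumEquiv_pure_inr e

end

/-- There is a well-defined family of bijections
`δ_X : Ultrafilter (X ⊕ E) → Ultrafilter X ⊕ E` (for `E` finite), natural in `X`,
defined by: if `Set.range Sum.inl ∈ 𝔉` then `δ_X 𝔉 = Sum.inl 𝒢` for the unique `𝒢` with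
`Ultrafilter.map Sum.inl 𝒢 = 𝔉`, and otherwise `δ_X 𝔉 = Sum.inr e` for the unique `e`
with `𝔉 = pure (Sum.inr e)`; and `δ` is an invertible distributive law between the
ultrafilter monad and the exception monad `(· ⊕ E)`. -/
theorem stmt_13 (E : Type u) [Finite E] :
    ∃ δ : ∀ X : Type u, Ultrafilter (X ⊕ E) → Ultrafilter X ⊕ E,
      -- the defining clauses (in particular, `δ` is well defined)
      (∀ (X : Type u) (𝔉 : Ultrafilter (X ⊕ E)),
        (Set.range (Sum.inl : X → X ⊕ E) ∈ 𝔉 →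
          (∃! 𝒢 : Ultrafilter X, Ultrafilter.map Sum.inl 𝒢 = 𝔉) ∧
          (∀ 𝒢 : Ultrafilter X, Ultrafilter.map Sum.inl 𝒢 = 𝔉 → δ X 𝔉 = Sum.inl 𝒢)) ∧
        (Set.range (Sum.inl : X → X ⊕ E) ∉ 𝔉 →
          (∃! e : E, 𝔉 = pure (Sum.inr e)) ∧
          (∀ e : E, 𝔉 = pure (Sum.inr e) → δ X 𝔉 = Sum.inr e))) ∧
      -- each `δ_X` is a bijection
      (∀ X : Type u, Function.Bijective (δ X)) ∧
      -- naturality in `X`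
      (∀ (X Y : Type u) (f : X → Y) (𝔉 : Ultrafilter (X ⊕ E)),
        δ Y (Ultrafilter.map (Sum.map f (id : E → E)) 𝔉) =
          Sum.map (Ultrafilter.map f) (id : E → E) (δ X 𝔉)) ∧
      -- (1) compatibility with the units
      (∀ (X : Type u) (w : X ⊕ E),
        δ X (pure w) = Sum.map (pure : X → Ultrafilter X) (id : E → E) w) ∧
      -- (2) compatibility with the unit of the exception monad
      (∀ (X : Type u) (𝒢 : Ultrafilter X),
        δ X (Ultrafilter.map (Sum.inl : X → X ⊕ E) 𝒢) = Sum.inl 𝒢) ∧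
      -- (3) compatibility with the multiplication of the exception monad
      (∀ (X : Type u) (𝔉 : Ultrafilter ((X ⊕ E) ⊕ E)),
        δ X (Ultrafilter.map (Sum.elim id Sum.inr : (X ⊕ E) ⊕ E → X ⊕ E) 𝔉) =
          (Sum.elim id Sum.inr : (Ultrafilter X ⊕ E) ⊕ E → Ultrafilter X ⊕ E)
            (Sum.map (δ X) (id : E → E) (δ (X ⊕ E) 𝔉))) ∧
      -- (4) compatibility with the multiplication of the ultrafilter monad
      (∀ (X : Type u) (𝔊 : Ultrafilter (Ultrafilter (X ⊕ E))),
        δ X (joinU 𝔊) =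
          Sum.map (joinU : Ultrafilter (Ultrafilter X) → Ultrafilter X) (id : E → E)
            (δ (Ultrafilter X) (Ultrafilter.map (δ X) 𝔊))) := by
  refine ⟨fun X => sumEquiv E X, fun X 𝔉 => ⟨fun h => ⟨?_, ?_⟩, fun h => ⟨?_, ?_⟩⟩,
    fun X => (sumEquiv E X).bijective, fun _ _ => sumEquiv_map_sumMap, fun _ => sumEquiv_pure,
    fun _ => sumEquiv_map_inl, fun _ => sumEquiv_map_sumElim, fun _ => sumEquiv_joinU⟩
  · obtain ⟨𝒢, rfl⟩ | ⟨e, rfl⟩ := eq_map_inl_or_eq_pure_inr 𝔉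
    · exact ⟨𝒢, rfl, fun _ h' => Ultrafilter.map_injective Sum.inl_injective h'⟩
    · exact (range_inl_notMem_pure_inr e h).elim
  · rintro 𝒢 rfl
    exact sumEquiv_map_inl 𝒢
  · obtain ⟨𝒢, rfl⟩ | ⟨e, rfl⟩ := eq_map_inl_or_eq_pure_inr 𝔉
    · exact (h (range_inl_mem_map_inl 𝒢)).elim
    · exact ⟨e, rfl, fun _ h' => Sum.inr_injective (Ultrafilter.pure_injective h'.symm)⟩
  · rintro e rfl
    exact sumEquiv_pure_inr e
end

section
/- Let κ be a regular cardinal, S, T : Type u ⥤ Type u functors, and m : S ⟶ T a monomorphism in the functor category Type u ⥤ Type u. If T is κ-accessible, i.e., T preserves colimits of shape J for every small κ-filtered category J, then S is κ-accessible as well. (Every subfunctor of a κ-accessible endofunctor of Type is κ-accessible.) -/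
open CategoryTheory CategoryTheory.Limits

universe u

/-- A category `J` is `κ`-filtered if every diagram in `J` of size `< κ` admits a
cocone. -/
def IsCardinalFiltered (J : Type u) [Category.{u} J] (κ : Cardinal.{u}) : Prop :=
  ∀ (A : Type u) [SmallCategory A], Cardinal.mk (Arrow A) < κ →
    ∀ F : A ⥤ J, Nonempty (Cocone F)

namespace CategoryTheory

/-- For `κ` regular, the two notions of `κ`-filtered small category agree. -/
theorem isCardinalFiltered_iff_root (J : Type u) [SmallCategory J] (κ : Cardinal.{u})
    [Fact κ.IsRegular] :
    CategoryTheory.IsCardinalFiltered J κ ↔ _root_.IsCardinalFiltered J κ :=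
  ⟨fun _ _ _ hA F ↦
      IsCardinalFiltered.nonempty_cocone F ((hasCardinalLT_iff_cardinal_mk_lt _ κ).2 hA),
    fun h ↦ ⟨fun F hA ↦ h _ ((hasCardinalLT_iff_cardinal_mk_lt _ κ).1 hA) F⟩⟩

namespace Functor

variable {κ : Cardinal.{u}} [Fact κ.IsRegular] {S T : Type u ⥤ Type u}

/-- Every element of the value at `X` of a `κ`-accessible endofunctor of `Type u` comes from
a retract of `X` of cardinality `< κ`. -/
theorem exists_retract_of_isCardinalAccessible [T.IsCardinalAccessible κ] {X : Type u}
    (x : T.obj X) :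
    ∃ (Y : Type u) (h : Retract Y X), HasCardinalLT Y κ ∧ ∃ y : T.obj Y, T.map h.i y = x := by
  have hκ : Cardinal.aleph0 ≤ κ := Cardinal.IsRegular.aleph0_le Fact.out
  rcases isEmpty_or_nonempty X with hX | ⟨⟨a⟩⟩
  · exact ⟨X, .refl X, hasCardinalLT_of_finite X κ hκ, x, by simp⟩
  have := T.preservesColimitsOfShape_of_isCardinalAccessible κ (HasCardinalLT.Set X κ)
  obtain ⟨A, y, rfl⟩ := Types.jointly_surjective_of_isColimit
    (isColimitOfPreserves T (HasCardinalLT.Set.isColimitCocone X κ hκ)) x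
  let B : HasCardinalLT.Set X κ :=
    ⟨A.1 ∪ {a}, hasCardinalLT_union hκ A.2 (hasCardinalLT_of_finite _ κ hκ)⟩
  let f : A ⟶ B := homOfLE (Set.subset_union_left : A.1 ⊆ A.1 ∪ {a})
  have ha : a ∈ B.1 := Or.inr rfl
  classical
  refine ⟨B.1, ⟨↾Subtype.val, ↾fun z ↦ if hz : z ∈ B.1 then ⟨z, hz⟩ else ⟨a, ha⟩, ?_⟩, B.2,
    T.map ((HasCardinalLT.Set.functor X κ).map f) y, ?_⟩
  · ext z
    simp
  · exact ConcreteCategory.congr_hom ((T.mapCocone (HasCardinalLT.Set.cocone X κ)).w f) y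

/-- If `S` is a subfunctor of `T` and `Y` is a retract of `X`, an element of `S.obj X` whose image
in `T.obj X` comes from `T.obj Y` comes itself from `S.obj Y`. -/
theorem map_map_eq_of_retract (m : S ⟶ T) [Mono m] {X Y : Type u} (h : Retract Y X)
    (s : S.obj X) (t : T.obj Y) (hst : T.map h.i t = m.app X s) :
    S.map h.i (S.map h.r s) = s := by
  apply (mono_iff_injective (m.app X)).1 inferInstance
  have hr : m.app Y (S.map h.r s) = t := by
    rw [NatTrans.naturality_apply, ← hst, ← ConcreteCategory.comp_apply, ← T.map_comp, h.retract]
    simp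
  rw [NatTrans.naturality_apply, hr, hst]

/-- Every subfunctor of a `κ`-accessible endofunctor of `Type u` is `κ`-accessible. -/
theorem isCardinalAccessible_of_mono (m : S ⟶ T) [Mono m] [T.IsCardinalAccessible κ] :
    S.IsCardinalAccessible κ where
  preservesColimitOfShape J _ _ := ⟨fun {F} ↦ ⟨fun {c} hc ↦ ⟨by
    have := isFiltered_of_isCardinalFiltered J κ
    have := T.preservesColimitsOfShape_of_isCardinalAccessible κ J
    refine Types.FilteredColimit.isColimitOf' _ _ (fun s ↦ ?_) (fun j x y hxy ↦ ?_)
    · obtain ⟨Y, h, hY, t, ht⟩ := exists_retract_of_isCardinalAccessible (κ := κ) (m.app c.pt s)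
      have := hY.isCardinalPresentable
      obtain ⟨j, g, hg⟩ := IsCardinalPresentable.exists_hom_of_isColimit κ hc h.i
      refine ⟨j, S.map g (S.map h.r s), ?_⟩
      conv_lhs => rw [← map_map_eq_of_retract m h s t ht, ← hg, S.map_comp]
      rfl
    · have hT : T.map (c.ι.app j) (m.app _ x) = T.map (c.ι.app j) (m.app _ y) := by
        rw [← NatTrans.naturality_apply, ← NatTrans.naturality_apply]
        exact congrArg (m.app c.pt) hxy
      obtain ⟨k, f, hf⟩ := (Types.FilteredColimit.isColimit_eq_iff'
        (isColimitOfPreserves T hc) (m.app _ x) (m.app _ y)).1 hT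
      refine ⟨k, f, (mono_iff_injective (m.app (F.obj k))).1 inferInstance ?_⟩
      exact (NatTrans.naturality_apply m (F.map f) x).trans
        (hf.trans (NatTrans.naturality_apply m (F.map f) y).symm)⟩⟩⟩

end Functor

end CategoryTheory

/-- Every subfunctor of a `κ`-accessible endofunctor of `Type` is `κ`-accessible, for
`κ` a regular cardinal: if `T` preserves colimits of every small `κ`-filtered shape and
`m : S ⟶ T` is a monomorphism of endofunctors, then `S` preserves such colimits too. -/
theorem stmt_18 (κ : Cardinal.{u}) (hκ : κ.IsRegular)
    (S T : Type u ⥤ Type u) (m : S ⟶ T) (hm : Mono m)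
    (hT : ∀ (J : Type u) [SmallCategory J], IsCardinalFiltered J κ →
      Nonempty (PreservesColimitsOfShape J T)) :
    ∀ (J : Type u) [SmallCategory J], IsCardinalFiltered J κ →
      Nonempty (PreservesColimitsOfShape J S) := by
  have : Fact κ.IsRegular := ⟨hκ⟩
  have : T.IsCardinalAccessible κ :=
    ⟨fun J _ hJ ↦ (hT J ((isCardinalFiltered_iff_root J κ).1 hJ)).some⟩
  intro J _ hJ
  have := (isCardinalFiltered_iff_root J κ).2 hJ
  have := Functor.isCardinalAccessible_of_mono (κ := κ) m
  exact ⟨S.preservesColimitsOfShape_of_isCardinalAccessible κ J⟩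
end

section
/- Let κ be a regular cardinal and X a type with κ ≤ #X. Then there exists an ultrafilter 𝔘 on X such that every set A ∈ 𝔘 has cardinality #A ≥ κ; consequently, for every S : Set X with #S < κ, the ultrafilter 𝔘 does not lie in the range of Ultrafilter.map (Subtype.val : S → X) : Ultrafilter S → Ultrafilter X. (This is the key step showing that the ultrafilter functor does not preserve κ-filtered colimits for any regular cardinal κ, i.e., the ultrafilter monad has no rank.) -/
universe u

/-- For a regular cardinal `κ` and a set `X` of cardinality at least `κ`, there is an
ultrafilter on `X` all of whose members have cardinality at least `κ`; consequently this
ultrafilter is not in the range of the pushforward along the inclusion of any subset of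
cardinality `< κ`.  (The ultrafilter monad has no rank.) -/
theorem stmt_19 (κ : Cardinal.{u}) (hκ : κ.IsRegular) (X : Type u)
    (hX : κ ≤ Cardinal.mk X) :
    ∃ 𝔘 : Ultrafilter X,
      (∀ A : Set X, A ∈ 𝔘 → κ ≤ Cardinal.mk A) ∧
      (∀ S : Set X, Cardinal.mk S < κ →
        𝔘 ∉ Set.range (Ultrafilter.map (Subtype.val : S → X))) := by
  have hne : (Filter.cocardinal X hκ).NeBot := by
    have h : (Filter.cocardinal X hκ ⊓ Filter.principal Set.univ).NeBot :=
      Filter.cocardinal_inf_principal_neBot_iff.2 (by rwa [Cardinal.mk_univ])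
    exact h.mono inf_le_left
  have hlarge : ∀ A : Set X, A ∈ Ultrafilter.of (Filter.cocardinal X hκ) →
      κ ≤ Cardinal.mk A := by
    intro A hA
    by_contra! hlt
    exact Ultrafilter.compl_notMem_iff.2 hA
      (Ultrafilter.of_le _ (Filter.compl_mem_cocardinal_of_card_lt hlt))
  refine ⟨Ultrafilter.of (Filter.cocardinal X hκ), hlarge, ?_⟩
  rintro S hS ⟨V, hV⟩
  refine (hlarge S ?_).not_gt hS
  rw [← hV, Ultrafilter.mem_map, Subtype.coe_preimage_self]
  exact Filter.univ_mem
end
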